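/- Let {X_n} be a stationary and ergodic time series with values in a finite or countably infinite set 𝒳 and let f : 𝒳 → ℝ be bounded. Then almost surely (1/n) Σ_{j=0}^{n−1} [ f(X_{λ_j+1}) − E(f(X_{λ_j+1}) | X_{−∞}^{λ_j}) ] → 0 as n → ∞. -/

import Mathlib

open MeasureTheory Filter Set
open scoped ENNReal Topology

noncomputable section

namespace MWPrediction

/-- The canonical two-sided path space for a process with values in `𝒳`. -/
abbrev Path (𝒳 : Type*) := ℤ → 𝒳

variable {𝒳 : Type*}

/-- The left shift `(T ω) i = ω (i+1)` on two-sided sequences. -/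
def shift (ω : Path 𝒳) : Path 𝒳 := fun i => ω (i + 1)

/-- The one-sided past `X⁰_{-∞}`, recorded as `past ω i = X_{-i}`. -/
def past (ω : Path 𝒳) : ℕ → 𝒳 := fun i => ω (-(i : ℤ))

/-- The string `s` of length `m` (read right-to-left: `s j` is the symbol at
position `t - j`) occurs in `ω` ending at time `t`. -/
def OccursAt (ω : Path 𝒳) (m : ℕ) (s : ℕ → 𝒳) (t : ℤ) : Prop :=
  ∀ j < m, ω (t - (j : ℤ)) = s j

/-- The auxiliary stopping times `ζ_n`:  `ζ_0 = 0` and `ζ_n` is obtained from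
`ζ_{n-1}` by waiting for the recurrence of the block of length `l n` ending
at `ζ_{n-1}`. -/
def zeta (l : ℕ → ℕ) (ω : Path 𝒳) : ℕ → ℤ
  | 0 => 0
  | n + 1 =>
    zeta l ω n +
      ((sInf {t : ℕ | 0 < t ∧ ∀ s < l (n + 1),
          ω (zeta l ω n - (s : ℤ) + (t : ℤ)) = ω (zeta l ω n - (s : ℤ))} : ℕ) : ℤ)

/-- `J n = min { j ≥ 1 : l (j+1) > n }`. -/
def Jfun (l : ℕ → ℕ) (n : ℕ) : ℕ := sInf {j : ℕ | 1 ≤ j ∧ n < l (j + 1)}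

/-- The auxiliary process `X̃`: `tildePast l ω i = X̃_{-i} = X_{ζ_{J(i)} - i}`. -/
def tildePast (l : ℕ → ℕ) (ω : Path 𝒳) : ℕ → 𝒳 :=
  fun i => ω (zeta l ω (Jfun l i) - (i : ℤ))

variable [MeasurableSpace 𝒳]

/-- `pstr μ m s = P(X_{-m+1}^0 = s)`, the probability that the string `s` of
length `m` (read right-to-left) occupies positions `-m+1, …, 0`.
(So `pstr μ (k+1)` is `p_k` of the paper.) -/
def pstr (μ : Measure (Path 𝒳)) (m : ℕ) (s : ℕ → 𝒳) : ℝ :=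
  (μ {ω | ∀ j < m, ω (-(j : ℤ)) = s j}).toReal

/-- `pcond μ m y s = P(X_1 = y | X_{-m+1}^0 = s)`, conditioning on `m` symbols.
(So `pcond μ m` is `p_{m-1}(·|·)` of the paper.) -/
def pcond (μ : Measure (Path 𝒳)) (m : ℕ) (y : 𝒳) (s : ℕ → 𝒳) : ℝ :=
  (μ {ω | ω 1 = y ∧ ∀ j < m, ω (-(j : ℤ)) = s j}).toReal / pstr μ m s

/-- Append `y` as the new rightmost symbol of the string `s`. -/
def withLast (y : 𝒳) (s : ℕ → 𝒳) : ℕ → 𝒳 := fun j => if j = 0 then y else s (j - 1)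

/-- The string which agrees with `b` on its rightmost `k` symbols and continues
to the left with `z`:  this is the string `(z, b_{-k+1}^0)` of the paper. -/
def prependOld (b : ℕ → 𝒳) (k : ℕ) (z : ℕ → 𝒳) : ℕ → 𝒳 :=
  fun j => if j < k then b j else z (j - k)

/-- `K` is a memory bound for the past `b`: for all `i ≥ 1`, `y` and `z ∈ 𝒳^i`,
if `p_{K+i}(z, b_{-K+1}^0, y) > 0` then
`p_{K-1}(y | b_{-K+1}^0) = p_{K+i-1}(y | z, b_{-K+1}^0)`. -/
def IsMemoryBound (μ : Measure (Path 𝒳)) (b : ℕ → 𝒳) (K : ℕ) : Prop :=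
  ∀ i : ℕ, 1 ≤ i → ∀ y : 𝒳, ∀ z : ℕ → 𝒳,
    0 < pstr μ (K + i + 1) (withLast y (prependOld b K z)) →
    pcond μ K y b = pcond μ (K + i) y (prependOld b K z)

/-- The (random) memory length `K(b)` of a one-sided path `b`: the smallest
memory bound, and `∞` if there is none. -/
def memLen (μ : Measure (Path 𝒳)) (b : ℕ → 𝒳) : ℕ∞ :=
  sInf {n : ℕ∞ | ∃ K : ℕ, n = (K : ℕ∞) ∧ IsMemoryBound μ b K}

/-- `Δ_k(b_{-k+1}^0)`. -/
def Delta (μ : Measure (Path 𝒳)) (k : ℕ) (b : ℕ → 𝒳) : ℝ :=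
  sSup {d : ℝ | ∃ i : ℕ, 1 ≤ i ∧ ∃ z : ℕ → 𝒳, ∃ x : 𝒳,
    0 < pstr μ (k + i + 1) (withLast x (prependOld b k z)) ∧
    d = |pcond μ k x b - pcond μ (k + i) x (prependOld b k z)|}

/-- `⌈n/2⌉`. -/
def half (n : ℕ) : ℕ := (n + 1) / 2

open Classical in
/-- The number of times `t ∈ [a, b]` at which the string `s` of length `m`
occurs in `ω` ending at `t`. -/
def cnt (ω : Path 𝒳) (m : ℕ) (s : ℕ → 𝒳) (a b : ℤ) : ℕ :=
  ((Finset.Icc a b).filter fun t => OccursAt ω m s t).card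

/-- Membership in `ℒ_{n,m}^{(1)}`: the string `s` of length `m+1` occurs in
`X_0^{⌈n/2⌉ - 1}`. -/
def inL1 (ω : Path 𝒳) (n m : ℕ) (s : ℕ → 𝒳) : Prop :=
  ∃ t : ℤ, (m : ℤ) ≤ t ∧ t ≤ (half n : ℤ) - 1 ∧ OccursAt ω (m + 1) s t

/-- Membership in `ℒ_{n,m}^{(2)}`: the string `s` of length `m+1` occurs more
than `n^{1-γ}` times in `X_{⌈n/2⌉}^n`. -/
def inL2 (γ : ℝ) (ω : Path 𝒳) (n m : ℕ) (s : ℕ → 𝒳) : Prop :=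
  (n : ℝ) ^ (1 - γ) < (cnt ω (m + 1) s ((half n : ℤ) + (m : ℤ)) (n : ℤ) : ℝ)

/-- Membership in `ℒ_m^n = ℒ_{n,m}^{(1)} ∩ ℒ_{n,m}^{(2)}`. -/
def inL (γ : ℝ) (ω : Path 𝒳) (n m : ℕ) (s : ℕ → 𝒳) : Prop :=
  inL1 ω n m s ∧ inL2 γ ω n m s

/-- The empirical conditional relative frequency of `x` following the string
`s` of length `m`, computed in the second half `X_{⌈n/2⌉}^n` of the data. -/
def empCond (ω : Path 𝒳) (n m : ℕ) (x : 𝒳) (s : ℕ → 𝒳) : ℝ :=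
  (cnt ω (m + 1) (withLast x s) ((half n : ℤ) + (m : ℤ)) (n : ℤ) : ℝ) /
    (cnt ω m s ((half n : ℤ) + (m : ℤ) - 1) ((n : ℤ) - 1) : ℝ)

/-- The empirical statistic `Δ̂_k^n(X̃_{-k+1}^0)`. -/
def hatDelta (γ : ℝ) (l : ℕ → ℕ) (ω : Path 𝒳) (n k : ℕ) : ℝ :=
  (if zeta l ω (Jfun l k) ≤ (half n : ℤ) - 1 then (1 : ℝ) else 0) *
    sSup {d : ℝ | ∃ i : ℕ, 1 ≤ i ∧ i ≤ n ∧ ∃ z : ℕ → 𝒳, ∃ x : 𝒳,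
      inL γ ω n (k + i) (withLast x (prependOld (tildePast l ω) k z)) ∧
      d = |empCond ω n k x (tildePast l ω) -
            empCond ω n (k + i) x (prependOld (tildePast l ω) k z)|}

/-- The order estimate `χ_n`: the smallest `0 ≤ k < n` with `Δ̂_k^n ≤ n^{-β}`
(and `χ_0 = 0`). -/
def chi (β γ : ℝ) (l : ℕ → ℕ) (ω : Path 𝒳) (n : ℕ) : ℕ :=
  sInf {k : ℕ | k < n ∧ hatDelta γ l ω n k ≤ (n : ℝ) ^ (-β)}

/-- The index `j` with `ζ_j ≤ v < ζ_{j+1}`. -/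
def jIndex (l : ℕ → ℕ) (ω : Path 𝒳) (v : ℤ) : ℕ := sInf {j : ℕ | v < zeta l ω (j + 1)}

/-- The stopping times `λ_n`:  `λ_0 = 0` and, if `ζ_j ≤ λ_{n-1} < ζ_{j+1}`,
`λ_n = min { t > λ_{n-1} : X_{t - χ_t + 1}^t = X_{ζ_j - χ_t + 1}^{ζ_j} }`. -/
def lambda (β γ : ℝ) (l : ℕ → ℕ) (ω : Path 𝒳) : ℕ → ℤ
  | 0 => 0
  | n + 1 =>
    lambda β γ l ω n + 1 +
      ((sInf {s : ℕ |
          ∀ r < chi β γ l ω (lambda β γ l ω n + 1 + (s : ℤ)).toNat,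
            ω (lambda β γ l ω n + 1 + (s : ℤ) - (r : ℤ)) =
              ω (zeta l ω (jIndex l ω (lambda β γ l ω n)) - (r : ℤ))} : ℕ) : ℤ)

/-- `κ_n = χ_{λ_n}`. -/
def kappa (β γ : ℝ) (l : ℕ → ℕ) (ω : Path 𝒳) (n : ℕ) : ℕ :=
  chi β γ l ω (lambda β γ l ω n).toNat

/-- The estimator `f_n = (1/n) ∑_{j=0}^{n-1} f(X_{λ_j + 1})`. -/
def fEst (β γ : ℝ) (l : ℕ → ℕ) (f : 𝒳 → ℝ) (ω : Path 𝒳) (n : ℕ) : ℝ :=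
  (1 / (n : ℝ)) * ∑ j ∈ Finset.range n, f (ω (lambda β γ l ω j + 1))

open Classical in
/-- The metric `d*` on one-sided sequences. -/
def dstar (x y : ℕ → 𝒳) : ℝ :=
  ∑' i : ℕ, (2 : ℝ)⁻¹ ^ (i + 1) * (if x i ≠ y i then 1 else 0)

/-- `F` restricted to `C` is continuous with respect to the metric `d*`. -/
def ContinuousOnDstar (F : (ℕ → 𝒳) → ℝ) (C : Set (ℕ → 𝒳)) : Prop :=
  ∀ x ∈ C, ∀ ε > 0, ∃ δ > 0, ∀ y ∈ C, dstar x y < δ → |F y - F x| < ε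

/-- The σ-algebra generated by the one-sided past `X^0_{-∞}`. -/
def pastSigma (𝒳 : Type*) [MeasurableSpace 𝒳] : MeasurableSpace (Path 𝒳) :=
  MeasurableSpace.comap past inferInstance

/-- `F` is a version of the conditional expectation `E(f(X_1) | X^0_{-∞})`. -/
def IsPredictor (μ : Measure (Path 𝒳)) (f : 𝒳 → ℝ) (F : (ℕ → 𝒳) → ℝ) : Prop :=
  (fun ω => F (past ω)) =ᵐ[μ] μ[fun ω => f (ω 1)|pastSigma 𝒳]

/-- `F` (a version of `E(f(X_1)|X^0_{-∞})`) is almost surely continuous: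
it is continuous w.r.t. `d*` on a set of paths of probability one. -/
def ASContinuousCondExp (μ : Measure (Path 𝒳)) (F : (ℕ → 𝒳) → ℝ) : Prop :=
  ∃ C : Set (ℕ → 𝒳), μ (past ⁻¹' C) = 1 ∧ ContinuousOnDstar F C

/-- The observation `(λ_j, X_0^{λ_j})`, encoding the data segment available at
time `λ_j` (values before time `0` are clamped to `X_0`). -/
def segObs (β γ : ℝ) (l : ℕ → ℕ) (j : ℕ) (ω : Path 𝒳) : ℤ × (ℕ → 𝒳) :=
  (lambda β γ l ω j, fun i => ω (max (lambda β γ l ω j - (i : ℤ)) 0))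

/-- The σ-algebra generated by `(λ_j, X_0^{λ_j})`. -/
def segSigma (β γ : ℝ) (l : ℕ → ℕ) (j : ℕ) : MeasurableSpace (Path 𝒳) :=
  MeasurableSpace.comap (segObs β γ l j) inferInstance

/-- The observation `(λ_j, X_{-∞}^{λ_j})`: the full past at time `λ_j`. -/
def fullPastObs (β γ : ℝ) (l : ℕ → ℕ) (j : ℕ) (ω : Path 𝒳) : ℤ × (ℕ → 𝒳) :=
  (lambda β γ l ω j, fun i => ω (lambda β γ l ω j - (i : ℤ)))

/-- The σ-algebra generated by `(λ_j, X_{-∞}^{λ_j})`. -/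
def fullPastSigma (β γ : ℝ) (l : ℕ → ℕ) (j : ℕ) : MeasurableSpace (Path 𝒳) :=
  MeasurableSpace.comap (fullPastObs β γ l j) inferInstance

/-- The `n`-th term `-(1/(n+1)) ∑ p log₂ p` of the entropy rate. -/
def entropyTerm (μ : Measure (Path 𝒳)) (n : ℕ) : ℝ :=
  -(1 / ((n : ℝ) + 1)) *
    ∑' s : Fin (n + 1) → 𝒳,
      pstr μ (n + 1) (fun j => if h : j < n + 1 then s ⟨j, h⟩ else s ⟨0, Nat.succ_pos n⟩) *
        Real.logb 2
          (pstr μ (n + 1) (fun j => if h : j < n + 1 then s ⟨j, h⟩ else s ⟨0, Nat.succ_pos n⟩))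

/-- The process has entropy rate `H`. -/
def HasEntropyRate (μ : Measure (Path 𝒳)) (H : ℝ) : Prop :=
  Tendsto (entropyTerm μ) atTop (nhds H)

/-- The backward stopping times `ζ̂_i^k`. -/
def hatZeta (l : ℕ → ℕ) (k : ℕ) (ω : Path 𝒳) : ℕ → ℤ
  | 0 => 0
  | i + 1 =>
    hatZeta l k ω i -
      ((sInf {t : ℕ | 0 < t ∧ ∀ s < l (k - i),
          ω (hatZeta l k ω i - (s : ℤ) - (t : ℤ)) = ω (hatZeta l k ω i - (s : ℤ))} : ℕ) : ℤ)


section Determinism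

variable {𝒳 : Type*}

/-- Every waiting time in the definition of `zeta` is finite. -/
def Recurs (l : ℕ → ℕ) (ω : Path 𝒳) : Prop :=
  ∀ n, ∃ t : ℕ, 0 < t ∧ ∀ s < l (n + 1),
    ω (zeta l ω n - (s : ℤ) + (t : ℤ)) = ω (zeta l ω n - (s : ℤ))

/-- The paths `ω` and `ω'` coincide at the times `0, …, T`. -/
def AgreeUpTo (T : ℤ) (ω ω' : Path 𝒳) : Prop := ∀ i : ℤ, 0 ≤ i → i ≤ T → ω i = ω' i

lemma AgreeUpTo.symm {T : ℤ} {ω ω' : Path 𝒳} (h : AgreeUpTo T ω ω') : AgreeUpTo T ω' ω :=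
  fun i h0 hT => (h i h0 hT).symm

lemma AgreeUpTo.mono {S T : ℤ} {ω ω' : Path 𝒳} (h : AgreeUpTo T ω ω') (hST : S ≤ T) :
    AgreeUpTo S ω ω' :=
  fun i h0 hS => h i h0 (hS.trans hST)

lemma sInf_eq_of_mem_iff {S S' : Set ℕ} (hS : S.Nonempty)
    (h : ∀ t ≤ sInf S, t ∈ S ↔ t ∈ S') : sInf S' = sInf S := by
  have h1 : sInf S ∈ S' := (h _ le_rfl).1 (Nat.sInf_mem hS)
  refine le_antisymm (Nat.sInf_le h1) ?_
  by_contra! hlt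
  have h2 : sInf S' ∈ S := (h _ hlt.le).2 (Nat.sInf_mem ⟨_, h1⟩)
  exact absurd (Nat.sInf_le h2) (not_le.2 hlt)

lemma zeta_succ_spec {l : ℕ → ℕ} {ω : Path 𝒳} (hω : Recurs l ω) (n : ℕ) :
    ∃ t : ℕ, 0 < t ∧ zeta l ω (n + 1) = zeta l ω n + t ∧
      ∀ s < l (n + 1), ω (zeta l ω n - (s : ℤ) + (t : ℤ)) = ω (zeta l ω n - (s : ℤ)) := by
  have := Nat.sInf_mem (hω n)
  exact ⟨_, this.1, rfl, this.2⟩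

lemma zeta_strictMono {l : ℕ → ℕ} {ω : Path 𝒳} (hω : Recurs l ω) : StrictMono (zeta l ω) :=
  strictMono_nat_of_lt_succ fun n => by
    obtain ⟨t, ht, h, -⟩ := zeta_succ_spec hω n
    omega

lemma le_zeta {l : ℕ → ℕ} {ω : Path 𝒳} (hω : Recurs l ω) (n : ℕ) : (n : ℤ) ≤ zeta l ω n := by
  induction n with
  | zero => simp [zeta]
  | succ n ih =>
    have := zeta_strictMono hω (Nat.lt_succ_self n)
    push_cast
    simp only [Nat.succ_eq_add_one] at this
    omega

lemma zeta_congr {l : ℕ → ℕ} (hlle : ∀ k, 1 ≤ k → l k ≤ k) {T : ℤ} {ω ω' : Path 𝒳}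
    (hω : Recurs l ω) (h : AgreeUpTo T ω ω') :
    ∀ n, zeta l ω n ≤ T → zeta l ω' n = zeta l ω n := by
  intro n
  induction n with
  | zero => intro _; rfl
  | succ n ih =>
    intro hT
    have hlt := zeta_strictMono hω (Nat.lt_succ_self n)
    have hn := le_zeta hω n
    have hz := ih (hlt.le.trans hT)
    have hl := hlle (n + 1) (by omega)
    simp only [zeta] at hT ⊢
    rw [hz]
    congr 2
    refine sInf_eq_of_mem_iff (hω n) fun t ht => ?_
    simp only [Set.mem_ofPred_eq]
    refine and_congr_right fun _ => forall₂_congr fun s hs => ?_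
    rw [h _ (by omega) (by omega), h (zeta l ω n - s) (by omega) (by omega)]

lemma zeta_le_iff {l : ℕ → ℕ} (hlle : ∀ k, 1 ≤ k → l k ≤ k) {T : ℤ} {ω ω' : Path 𝒳}
    (hω : Recurs l ω) (hω' : Recurs l ω') (h : AgreeUpTo T ω ω') (n : ℕ) {v : ℤ} (hv : v ≤ T) :
    zeta l ω n ≤ v ↔ zeta l ω' n ≤ v := by
  constructor
  · intro hz
    rw [zeta_congr hlle hω h n (hz.trans hv)]
    exact hz
  · intro hz
    rw [zeta_congr hlle hω' h.symm n (hz.trans hv)]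
    exact hz

lemma Jfun_spec {l : ℕ → ℕ} (hltop : Tendsto l atTop atTop) (n : ℕ) :
    1 ≤ Jfun l n ∧ n < l (Jfun l n + 1) := by
  refine Nat.sInf_mem (s := {j : ℕ | 1 ≤ j ∧ n < l (j + 1)}) ?_
  obtain ⟨j, h1, h2⟩ := ((eventually_ge_atTop 1).and
    (((tendsto_add_atTop_iff_nat 1).2 hltop).eventually_gt_atTop n)).exists
  exact ⟨j, h1, h2⟩

lemma Jfun_mono {l : ℕ → ℕ} (hltop : Tendsto l atTop atTop) : Monotone (Jfun l) := by
  intro m n hmn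
  obtain ⟨h1, h2⟩ := Jfun_spec hltop n
  exact Nat.sInf_le ⟨h1, hmn.trans_lt h2⟩

lemma cnt_congr {ω ω' : Path 𝒳} {m : ℕ} {s s' : ℕ → 𝒳} {a b : ℤ}
    (hω : AgreeUpTo b ω ω') (ha : (m : ℤ) ≤ a + 1) (hs : ∀ j < m, s j = s' j) :
    cnt ω m s a b = cnt ω' m s' a b := by
  unfold cnt
  congr 1
  classical
  refine Finset.filter_congr fun t ht => forall₂_congr fun j hj => ?_
  rw [Finset.mem_Icc] at ht
  rw [hω _ (by omega) (by omega), hs j hj]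

lemma empCond_congr {ω ω' : Path 𝒳} {n m : ℕ} (x : 𝒳) {s s' : ℕ → 𝒳}
    (hω : AgreeUpTo n ω ω') (hs : ∀ j < m, s j = s' j) :
    empCond ω n m x s = empCond ω' n m x s' := by
  unfold empCond
  rw [cnt_congr (s' := withLast x s') hω (by push_cast; omega),
    cnt_congr (s' := s') (hω.mono (by omega)) (by omega) hs]
  intro j hj
  unfold withLast
  split_ifs
  · rfl
  · exact hs _ (by omega)

lemma inL_congr (γ : ℝ) {ω ω' : Path 𝒳} {n m : ℕ} (s : ℕ → 𝒳) (hω : AgreeUpTo n ω ω') :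
    inL γ ω n m s ↔ inL γ ω' n m s := by
  unfold inL inL2 inL1 OccursAt
  rw [cnt_congr hω (by push_cast; omega) (fun _ _ => rfl)]
  refine and_congr_left fun _ => exists_congr fun t => and_congr_right fun h1 =>
    and_congr_right fun h2 => forall₂_congr fun j hj => ?_
  have : half n ≤ n + 1 := by unfold half; omega
  rw [hω _ (by omega) (by omega)]

lemma prependOld_congr {b b' : ℕ → 𝒳} {k : ℕ} (h : ∀ i < k, b i = b' i) (z : ℕ → 𝒳) :
    prependOld b k z = prependOld b' k z := by
  ext j
  unfold prependOld
  split_ifs with hj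
  · exact h j hj
  · rfl

lemma hatDelta_congr (γ : ℝ) {l : ℕ → ℕ} {ω ω' : Path 𝒳} {n k : ℕ} (hω : AgreeUpTo n ω ω')
    (hz : zeta l ω (Jfun l k) ≤ (half n : ℤ) - 1 ↔ zeta l ω' (Jfun l k) ≤ (half n : ℤ) - 1)
    (ht : zeta l ω (Jfun l k) ≤ (half n : ℤ) - 1 →
      ∀ i < k, tildePast l ω i = tildePast l ω' i) :
    hatDelta γ l ω n k = hatDelta γ l ω' n k := by
  unfold hatDelta
  by_cases h : zeta l ω (Jfun l k) ≤ (half n : ℤ) - 1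
  · rw [if_pos h, if_pos (hz.1 h)]
    congr 2
    ext d
    simp only [Set.mem_ofPred_eq]
    refine exists_congr fun i => and_congr_right fun _ => and_congr_right fun _ =>
      exists_congr fun z => exists_congr fun x => ?_
    rw [prependOld_congr (ht h), inL_congr γ _ hω, empCond_congr x hω (ht h),
      empCond_congr x hω (fun _ _ => rfl)]
  · rw [if_neg h, if_neg (fun h' => h (hz.2 h')), zero_mul, zero_mul]

variable {l : ℕ → ℕ} {ω ω' : Path 𝒳} {T : ℤ}

lemma chi_congr (β γ : ℝ) (hlle : ∀ k, 1 ≤ k → l k ≤ k) (hltop : Tendsto l atTop atTop)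
    (hω : Recurs l ω) (hω' : Recurs l ω') (h : AgreeUpTo T ω ω') {n : ℕ} (hn : (n : ℤ) ≤ T) :
    chi β γ l ω n = chi β γ l ω' n := by
  unfold chi
  congr 1
  ext k
  simp only [Set.mem_ofPred_eq]
  have hhalf : half n ≤ n + 1 := by unfold half; omega
  rw [hatDelta_congr γ (h.mono hn) (zeta_le_iff hlle hω hω' h _ (by omega))]
  intro hz i hi
  have hJ := (zeta_strictMono hω).monotone (Jfun_mono hltop hi.le)
  have hi' : (i : ℤ) ≤ zeta l ω (Jfun l i) := by
    have h1 := le_zeta hω (Jfun l i)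
    have h2 := (Jfun_spec hltop i).2
    have h3 := hlle (Jfun l i + 1) (by omega)
    omega
  unfold tildePast
  rw [zeta_congr hlle hω h _ (by omega), h _ (by omega) (by omega)]

lemma chi_le (β γ : ℝ) (l : ℕ → ℕ) (ω : Path 𝒳) (n : ℕ) : chi β γ l ω n ≤ n := by
  unfold chi
  rcases Set.eq_empty_or_nonempty {k : ℕ | k < n ∧ hatDelta γ l ω n k ≤ (n : ℝ) ^ (-β)} with h | h
  · simp [h]
  · exact (Nat.sInf_mem h).1.le

lemma chi_le_block (β γ : ℝ) (hlmono : Monotone l) (hltop : Tendsto l atTop atTop)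
    (hω : Recurs l ω) {n j : ℕ} (hn : 1 ≤ n) (hj : (n : ℤ) ≤ zeta l ω (j + 1)) :
    chi β γ l ω n ≤ l (j + 1) := by
  rcases le_or_gt n (l (j + 1)) with hnl | hnl
  · exact (chi_le β γ l ω n).trans hnl
  · refine Nat.sInf_le ⟨hnl, ?_⟩
    have hJ : j + 1 ≤ Jfun l (l (j + 1)) := by
      by_contra! hlt
      exact absurd (Jfun_spec hltop (l (j + 1))).2 (not_lt.2 (hlmono (by omega)))
    have := (zeta_strictMono hω).monotone hJ
    have hhalf : half n ≤ n := by unfold half; omega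
    unfold hatDelta
    rw [if_neg (by omega), zero_mul]
    positivity

lemma jIndex_spec (hω : Recurs l ω) {v : ℤ} (hv : 0 ≤ v) :
    zeta l ω (jIndex l ω v) ≤ v ∧ v < zeta l ω (jIndex l ω v + 1) := by
  have hne : {j : ℕ | v < zeta l ω (j + 1)}.Nonempty := by
    refine ⟨v.toNat, ?_⟩
    have := le_zeta hω (v.toNat + 1)
    simp only [Set.mem_ofPred_eq]
    omega
  refine ⟨?_, Nat.sInf_mem hne⟩
  rcases Nat.eq_zero_or_pos (jIndex l ω v) with h0 | h0
  · rw [h0]; exact hv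
  · by_contra! hlt
    have h1 : jIndex l ω v - 1 ∈ {j : ℕ | v < zeta l ω (j + 1)} := by
      simp only [Set.mem_ofPred_eq]
      rwa [Nat.sub_add_cancel h0]
    have h2 : jIndex l ω v ≤ jIndex l ω v - 1 := Nat.sInf_le h1
    omega

lemma jIndex_congr (hlle : ∀ k, 1 ≤ k → l k ≤ k) (hω : Recurs l ω) (hω' : Recurs l ω')
    (h : AgreeUpTo T ω ω') {v : ℤ} (hv : v ≤ T) : jIndex l ω v = jIndex l ω' v := by
  unfold jIndex
  congr 1
  ext j
  simp only [Set.mem_ofPred_eq]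
  rw [← not_le, ← not_le, zeta_le_iff hlle hω hω' h _ hv]

lemma lambda_nonneg (β γ : ℝ) (l : ℕ → ℕ) (ω : Path 𝒳) (n : ℕ) : 0 ≤ lambda β γ l ω n := by
  induction n with
  | zero => exact le_rfl
  | succ n ih => simp only [lambda]; omega

lemma lambda_strictMono (β γ : ℝ) (l : ℕ → ℕ) (ω : Path 𝒳) : StrictMono (lambda β γ l ω) :=
  strictMono_nat_of_lt_succ fun n => by simp only [lambda]; omega

lemma zeta_next_mem (β γ : ℝ) (hlmono : Monotone l) (hltop : Tendsto l atTop atTop)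
    (hω : Recurs l ω) {v : ℤ} (hv : 0 ≤ v) :
    (zeta l ω (jIndex l ω v + 1) - v - 1).toNat ∈ {s : ℕ |
      ∀ r < chi β γ l ω (v + 1 + (s : ℤ)).toNat,
        ω (v + 1 + (s : ℤ) - (r : ℤ)) = ω (zeta l ω (jIndex l ω v) - (r : ℤ))} := by
  obtain ⟨-, h2⟩ := jIndex_spec hω hv
  intro r hr
  rw [Int.toNat_of_nonneg (by omega)] at hr ⊢
  have h3 : v + 1 + (zeta l ω (jIndex l ω v + 1) - v - 1) = zeta l ω (jIndex l ω v + 1) := by ring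
  rw [h3] at hr ⊢
  have hle := chi_le_block β γ hlmono hltop hω (n := (zeta l ω (jIndex l ω v + 1)).toNat)
    (j := jIndex l ω v) (by omega) (by omega)
  obtain ⟨t, -, ht, hrec⟩ := zeta_succ_spec hω (jIndex l ω v)
  rw [← hrec r (by omega), ht]
  congr 1
  ring

lemma lambda_congr (β γ : ℝ) (hlmono : Monotone l) (hlle : ∀ k, 1 ≤ k → l k ≤ k)
    (hltop : Tendsto l atTop atTop) (hω : Recurs l ω) (hω' : Recurs l ω')
    (h : AgreeUpTo T ω ω') :
    ∀ n, lambda β γ l ω n ≤ T → lambda β γ l ω' n = lambda β γ l ω n := by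
  intro n
  induction n with
  | zero => intro _; rfl
  | succ n ih =>
    intro hT
    have h0 := lambda_nonneg β γ l ω n
    have hlt := lambda_strictMono β γ l ω (Nat.lt_succ_self n)
    have hv := ih (hlt.le.trans hT)
    simp only [lambda] at hT ⊢
    rw [hv]
    set v := lambda β γ l ω n
    have hmem := zeta_next_mem β γ hlmono hltop hω h0
    have hsInf := Nat.sInf_le hmem
    congr 2
    refine sInf_eq_of_mem_iff ⟨_, hmem⟩ fun s hs => ?_
    obtain ⟨hz1, hz2⟩ := jIndex_spec hω h0
    have hblock := chi_le_block β γ hlmono hltop hω (n := (v + 1 + s).toNat)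
      (j := jIndex l ω v) (by omega) (by omega)
    have hchi := chi_le β γ l ω (v + 1 + s).toNat
    have hl := hlle (jIndex l ω v + 1) (by omega)
    have hz := le_zeta hω (jIndex l ω v)
    simp only [Set.mem_ofPred_eq]
    rw [← jIndex_congr hlle hω hω' h (by omega), zeta_congr hlle hω h _ (by omega),
      ← chi_congr β γ hlle hltop hω hω' h (by omega)]
    refine forall₂_congr fun r hr => ?_
    rw [h _ (by omega) (by omega), h (zeta l ω (jIndex l ω v) - r) (by omega) (by omega)]

variable {β γ : ℝ}

/-- Some recurrent path with `λ_i = s` coincides with `ω` at the times `0, …, s`. -/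
def LambdaPrefix (β γ : ℝ) (l : ℕ → ℕ) (i : ℕ) (ω : Path 𝒳) (s : ℕ) : Prop :=
  ∃ ω', Recurs l ω' ∧ lambda β γ l ω' i = s ∧ AgreeUpTo s ω' ω

/-- The value of `λ_i` as read off from an initial segment of the path. -/
def prefixLambda (β γ : ℝ) (l : ℕ → ℕ) (i : ℕ) (ω : Path 𝒳) : ℕ :=
  sInf {s | LambdaPrefix β γ l i ω s}

/-- The path with past `p.2` at time `p.1`, frozen afterwards. -/
def frozenPath (p : ℤ × (ℕ → 𝒳)) : Path 𝒳 := fun i => p.2 (p.1 - i).toNat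

lemma prefixLambda_eq (hlmono : Monotone l)
    (hlle : ∀ k, 1 ≤ k → l k ≤ k)
    (hltop : Tendsto l atTop atTop) (hω : Recurs l ω)
    (h : AgreeUpTo T ω ω') {i : ℕ} (hi : lambda β γ l ω i ≤ T) :
    (prefixLambda β γ l i ω' : ℤ) = lambda β γ l ω i := by
  have h0 := lambda_nonneg β γ l ω i
  have hmem : (lambda β γ l ω i).toNat ∈ {s | LambdaPrefix β γ l i ω' s} :=
    ⟨ω, hω, by omega, h.mono (by omega)⟩
  have hle : prefixLambda β γ l i ω' ≤ (lambda β γ l ω i).toNat := Nat.sInf_le hmem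
  obtain ⟨ω₀, hω₀, hs, hag⟩ := Nat.sInf_mem ⟨_, hmem⟩
  change lambda β γ l ω₀ i = prefixLambda β γ l i ω' at hs
  change AgreeUpTo (prefixLambda β γ l i ω') ω₀ ω' at hag
  have hag' : AgreeUpTo (prefixLambda β γ l i ω') ω₀ ω := fun j hj0 hj =>
    (hag j hj0 hj).trans (h j hj0 (by omega)).symm
  rw [lambda_congr β γ hlmono hlle hltop hω₀ hω hag' i hs.le, hs]

lemma frozenPath_fullPastObs {j : ℕ} {i : ℤ} (hi : i ≤ lambda β γ l ω j) : frozenPath (fullPastObs β γ l j ω) i = ω i := by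
  simp only [frozenPath, fullPastObs]
  congr 1
  omega

/-- The value and the full past at time `λ_i`, as read off from a longer past `p`. -/
def prefixObs (β γ : ℝ) (l : ℕ → ℕ) (i : ℕ) (p : ℤ × (ℕ → 𝒳)) :
    𝒳 × ℤ × (ℕ → 𝒳) :=
  (frozenPath p ((prefixLambda β γ l i (frozenPath p) : ℤ) + 1),
    (prefixLambda β γ l i (frozenPath p) : ℤ),
    fun k => frozenPath p ((prefixLambda β γ l i (frozenPath p) : ℤ) - (k : ℤ)))

lemma prefixObs_fullPastObs (hlmono : Monotone l)
    (hlle : ∀ k, 1 ≤ k → l k ≤ k) (hltop : Tendsto l atTop atTop)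
    (hω : Recurs l ω) {i j : ℕ} (hij : i < j) :
    prefixObs β γ l i (fullPastObs β γ l j ω) =
      (ω (lambda β γ l ω i + 1), fullPastObs β γ l i ω) := by
  have hlt := lambda_strictMono β γ l ω hij
  have hpre := prefixLambda_eq (ω' := frozenPath (fullPastObs β γ l j ω)) hlmono hlle hltop hω
    (fun k _ hk => (frozenPath_fullPastObs hk).symm) hlt.le
  simp only [prefixObs, hpre, frozenPath_fullPastObs (show lambda β γ l ω i + 1 ≤ _ from hlt)]
  congr 2
  funext k
  exact frozenPath_fullPastObs (by omega)

lemma shift_iterate (ω : Path 𝒳) (k : ℕ) (i : ℤ) : shift^[k] ω i = ω (i + k) := by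
  induction k generalizing ω with
  | zero => simp
  | succ k ih =>
    rw [Function.iterate_succ_apply, ih]
    simp only [shift]
    congr 1
    push_cast
    ring

end Determinism

section Measurability

lemma measurable_of_factorsThrough {Ω C γ : Type*} [MeasurableSpace Ω] [Countable C]
    [MeasurableSpace C] [MeasurableSingletonClass C] [MeasurableSpace γ] [Nonempty γ]
    {φ : Ω → C} (hφ : Measurable φ) {F : Ω → γ} (h : F.FactorsThrough φ) : Measurable F := by
  rw [← h.extend_comp (fun _ => Classical.arbitrary γ)]
  exact (measurable_of_countable _).comp hφ

lemma measurable_apply_countable {Ω ι γ : Type*} [MeasurableSpace Ω] [Countable ι]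
    [MeasurableSpace ι] [MeasurableSingletonClass ι] [MeasurableSpace γ]
    {F : ι → Ω → γ} (hF : ∀ i, Measurable (F i)) {g : Ω → ι} (hg : Measurable g) :
    Measurable fun ω => F (g ω) ω :=
  (measurable_from_prod_countable_right (f := fun p : ι × Ω => F p.1 p.2) hF).comp
    (hg.prodMk measurable_id)

lemma measurable_nat_sInf {Ω : Type*} [MeasurableSpace Ω] {S : Ω → Set ℕ}
    (hS : ∀ n, Measurable fun ω => n ∈ S ω) : Measurable fun ω => sInf (S ω) := by
  have key : ∀ ω n, sInf (S ω) = n ↔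
      (n ∈ S ω ∧ ∀ m, m < n → ¬ m ∈ S ω) ∨ (n = 0 ∧ ∀ m, ¬ m ∈ S ω) := by
    intro ω n
    constructor
    · rintro rfl
      rcases (S ω).eq_empty_or_nonempty with h | h
      · right; simp [h]
      · exact Or.inl ⟨Nat.sInf_mem h, fun m hm => Nat.notMem_of_lt_sInf hm⟩
    · rintro (⟨h1, h2⟩ | ⟨rfl, h⟩)
      · refine le_antisymm (Nat.sInf_le h1) ?_
        by_contra! hlt
        exact h2 _ hlt (Nat.sInf_mem ⟨n, h1⟩)
      · rw [Set.eq_empty_of_forall_notMem h, Nat.sInf_empty]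
  refine measurable_to_countable' fun n => ?_
  have : (fun ω => sInf (S ω)) ⁻¹' {n} = {ω | (n ∈ S ω ∧ ∀ m, m < n → ¬ m ∈ S ω) ∨
      (n = 0 ∧ ∀ m, ¬ m ∈ S ω)} := by
    ext ω
    exact key ω n
  rw [this]
  exact measurableSet_setOfPred.2 (((hS n).and (Measurable.forall fun m =>
    measurable_const.imp (hS m).not)).or (measurable_const.and
      (Measurable.forall fun m => (hS m).not)))

lemma measurable_eval {Ω : Type*} [MeasurableSpace Ω] {p : Ω → Path 𝒳} (hp : Measurable p)
    {g : Ω → ℤ} (hg : Measurable g) : Measurable fun ω => p ω (g ω) :=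
  measurable_apply_countable (F := fun i ω => p ω i)
    (fun i => (measurable_pi_apply i).comp hp) hg

lemma measurable_frozenPath : Measurable (frozenPath : ℤ × (ℕ → 𝒳) → Path 𝒳) := by
  refine measurable_pi_lambda _ fun i => ?_
  exact measurable_apply_countable (F := fun n (p : ℤ × (ℕ → 𝒳)) => p.2 n)
    (fun n => (measurable_pi_apply n).comp measurable_snd)
    ((measurable_of_countable (fun z : ℤ => (z - i).toNat)).comp measurable_fst)

variable [Countable 𝒳] [MeasurableSingletonClass 𝒳]

lemma measurable_eval_eq {g h : Path 𝒳 → ℤ} (hg : Measurable g) (hh : Measurable h) :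
    Measurable fun ω : Path 𝒳 => ω (g ω) = ω (h ω) :=
  measurableSet_setOfPred.1 (((measurable_eval measurable_id hg).prodMk
    (measurable_eval measurable_id hh)) (Set.to_countable {p : 𝒳 × 𝒳 | p.1 = p.2}).measurableSet)

lemma measurable_zeta (l : ℕ → ℕ) (n : ℕ) : Measurable fun ω : Path 𝒳 => zeta l ω n := by
  induction n with
  | zero => exact measurable_const
  | succ n ih =>
    refine ih.add ((measurable_of_countable (fun n : ℕ => (n : ℤ))).comp
      (measurable_nat_sInf fun t => ?_))
    exact measurable_const.and (Measurable.forall fun s => measurable_const.imp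
      (measurable_eval_eq ((ih.sub_const _).add_const _) (ih.sub_const _)))

lemma measurable_tildePast (l : ℕ → ℕ) (i : ℕ) :
    Measurable fun ω : Path 𝒳 => tildePast l ω i :=
  measurable_eval measurable_id ((measurable_zeta l _).sub_const _)

lemma measurable_hatDelta (γ : ℝ) (l : ℕ → ℕ) (n k : ℕ) :
    Measurable fun ω : Path 𝒳 => hatDelta γ l ω n k := by
  refine measurable_of_factorsThrough (C := ℤ × (Fin k → 𝒳) × (Fin (n + 1) → 𝒳))
    (φ := fun ω => (zeta l ω (Jfun l k), (fun i => tildePast l ω i), fun i => ω (i : ℕ)))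
    ((measurable_zeta l _).prodMk ((measurable_pi_lambda _ fun i : Fin k => measurable_tildePast l i).prodMk
      (measurable_pi_lambda _ fun i : Fin (n + 1) => measurable_pi_apply ((i : ℕ) : ℤ)))) ?_
  intro ω ω' h
  simp only [Prod.mk.injEq] at h
  obtain ⟨h1, h2, h3⟩ := h
  refine hatDelta_congr γ (fun i h0 hi => ?_) (by rw [h1]) fun _ i hi => congrFun h2 ⟨i, hi⟩
  have := congrFun h3 ⟨i.toNat, by omega⟩
  simpa [Int.toNat_of_nonneg h0] using this

lemma measurable_chi (β γ : ℝ) (l : ℕ → ℕ) (n : ℕ) :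
    Measurable fun ω : Path 𝒳 => chi β γ l ω n :=
  measurable_nat_sInf fun _ => measurable_const.and
    (measurableSet_setOfPred.1 (measurableSet_le (measurable_hatDelta γ l n _) measurable_const))

lemma measurable_jIndex (l : ℕ → ℕ) {v : Path 𝒳 → ℤ} (hv : Measurable v) :
    Measurable fun ω => jIndex l ω (v ω) :=
  measurable_nat_sInf fun _ =>
    measurableSet_setOfPred.1 (measurableSet_lt hv (measurable_zeta l _))

lemma measurable_lambda (β γ : ℝ) (l : ℕ → ℕ) (n : ℕ) :
    Measurable fun ω : Path 𝒳 => lambda β γ l ω n := by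
  induction n with
  | zero => exact measurable_const
  | succ n ih =>
    refine (ih.add_const 1).add ((measurable_of_countable (fun n : ℕ => (n : ℤ))).comp
      (measurable_nat_sInf fun s => Measurable.forall fun r => Measurable.imp ?_ ?_))
    · refine measurableSet_setOfPred.1 (measurableSet_lt measurable_const ?_)
      exact measurable_apply_countable (fun n => measurable_chi β γ l n)
        ((measurable_of_countable Int.toNat).comp ((ih.add_const 1).add_const _))
    · refine measurable_eval_eq (((ih.add_const 1).add_const _).sub_const _)
        (Measurable.sub_const ?_ _)
      exact measurable_apply_countable (fun n => measurable_zeta l n) (measurable_jIndex l ih)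

lemma measurable_fullPastObs (β γ : ℝ) (l : ℕ → ℕ) (j : ℕ) :
    Measurable (fullPastObs β γ l j : Path 𝒳 → ℤ × (ℕ → 𝒳)) :=
  (measurable_lambda β γ l j).prodMk (measurable_pi_lambda _ fun _ =>
    measurable_eval measurable_id ((measurable_lambda β γ l j).sub_const _))

lemma fullPastSigma_le (β γ : ℝ) (l : ℕ → ℕ) (j : ℕ) :
    fullPastSigma (𝒳 := 𝒳) β γ l j ≤ MeasurableSpace.pi :=
  (measurable_fullPastObs β γ l j).comap_le

lemma measurable_prefixLambda (β γ : ℝ) (l : ℕ → ℕ) (i : ℕ) :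
    Measurable (prefixLambda β γ l i : Path 𝒳 → ℕ) := by
  refine measurable_nat_sInf fun s => ?_
  refine measurable_of_factorsThrough (C := Fin (s + 1) → 𝒳) (φ := fun ω i => ω (i : ℕ))
    (measurable_pi_lambda _ fun _ => measurable_pi_apply _) ?_
  intro ω ω' h
  have hagree : AgreeUpTo s ω ω' := fun i h0 hi => by
    have := congrFun h ⟨i.toNat, by omega⟩
    simpa [Int.toNat_of_nonneg h0] using this
  refine propext (exists_congr fun ω₀ => and_congr_right fun _ => and_congr_right fun _ => ?_)
  exact ⟨fun h' j h0 hj => (h' j h0 hj).trans (hagree j h0 hj),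
    fun h' j h0 hj => (h' j h0 hj).trans (hagree j h0 hj).symm⟩

lemma measurable_prefixObs (β γ : ℝ) (l : ℕ → ℕ) (i : ℕ) :
    Measurable (prefixObs β γ l i : ℤ × (ℕ → 𝒳) → 𝒳 × ℤ × (ℕ → 𝒳)) := by
  have h : Measurable fun p : ℤ × (ℕ → 𝒳) => (prefixLambda β γ l i (frozenPath p) : ℤ) :=
    (measurable_of_countable (fun n : ℕ => (n : ℤ))).comp
      ((measurable_prefixLambda β γ l i).comp measurable_frozenPath)
  exact (measurable_eval measurable_frozenPath (h.add_const 1)).prodMk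
    (h.prodMk (measurable_pi_lambda _ fun _ =>
      measurable_eval measurable_frozenPath (h.sub_const _)))

lemma ae_recurs {μ : Measure (Path 𝒳)}
    [IsFiniteMeasure μ] (hμ : MeasurePreserving (shift : Path 𝒳 → Path 𝒳) μ μ) (l : ℕ → ℕ) :
    ∀ᵐ ω ∂μ, Recurs l ω := by
  have hcons : ∀ᵐ ω ∂μ, ∀ (m : ℕ) (s : Fin m → 𝒳) (k : ℕ),
      shift^[k] ω ∈ {ω : Path 𝒳 | ∀ j : Fin m, ω (-(j : ℕ)) = s j} →
      ∃ᶠ n in atTop, shift^[n] ω ∈ {ω : Path 𝒳 | ∀ j : Fin m, ω (-(j : ℕ)) = s j} := by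
    refine ae_all_iff.2 fun m => ae_all_iff.2 fun s => ?_
    refine hμ.conservative.ae_forall_image_mem_imp_frequently_image_mem
      (MeasurableSet.nullMeasurableSet (measurableSet_setOfPred.2 (Measurable.forall fun j => ?_)))
    have h : Measurable fun ω : Path 𝒳 => ω (-((j : ℕ) : ℤ)) := measurable_pi_apply _
    exact measurableSet_setOfPred.1 (h (measurableSet_singleton (s j)))
  filter_upwards [hcons] with ω h n
  have h0 : 0 ≤ zeta l ω n := by
    induction n with
    | zero => exact le_rfl
    | succ n ih => simp only [zeta]; omega
  obtain ⟨N, hN, hmem⟩ := (frequently_atTop.1 (h (l (n + 1)) (fun j => ω (zeta l ω n - (j : ℕ)))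
    (zeta l ω n).toNat (fun j => by
      rw [shift_iterate]
      congr 1
      omega))) ((zeta l ω n).toNat + 1)
  refine ⟨N - (zeta l ω n).toNat, by omega, fun s hs => ?_⟩
  rw [← hmem ⟨s, hs⟩, shift_iterate]
  congr 1
  dsimp only
  omega

end Measurability

section Orthogonal

variable {Ω : Type*} [MeasurableSpace Ω] {μ : Measure Ω} [IsProbabilityMeasure μ]

lemma integral_sq_sum_le_of_orthogonal {d : ℕ → Ω → ℝ} {C : ℝ}
    (hd : ∀ j, AEStronglyMeasurable (d j) μ) (hC : ∀ j, ∀ᵐ ω ∂μ, |d j ω| ≤ C)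
    (horth : ∀ i j, i < j → ∫ ω, d i ω * d j ω ∂μ = 0) (n : ℕ) :
    ∫ ω, (∑ j ∈ Finset.range n, d j ω) ^ 2 ∂μ ≤ n * C ^ 2 := by
  have hmem : ∀ j, MemLp (d j) 2 μ := fun j => MemLp.of_bound (hd j) C (hC j)
  have hprod : ∀ i j, Integrable (fun ω => d i ω * d j ω) μ := fun i j =>
    (hmem i).integrable_mul (hmem j)
  induction n with
  | zero => simp
  | succ n ih =>
    have hS : MemLp (fun ω => ∑ j ∈ Finset.range n, d j ω) 2 μ :=
      memLp_finsetSum _ fun j _ => hmem j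
    have hcross : ∫ ω, (∑ j ∈ Finset.range n, d j ω) * d n ω ∂μ = 0 := by
      simp_rw [Finset.sum_mul]
      rw [integral_finsetSum _ fun j _ => hprod j n]
      exact Finset.sum_eq_zero fun j hj => horth j n (Finset.mem_range.1 hj)
    have hsq : ∫ ω, d n ω ^ 2 ∂μ ≤ C ^ 2 := by
      calc ∫ ω, d n ω ^ 2 ∂μ ≤ ∫ _, C ^ 2 ∂μ := by
            refine integral_mono_ae (hmem n).integrable_sq (integrable_const _) ?_
            filter_upwards [hC n] with ω h
            exact sq_le_sq' (abs_le.1 h).1 (abs_le.1 h).2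
        _ = C ^ 2 := by simp
    have hexp : ∀ ω, (∑ j ∈ Finset.range (n + 1), d j ω) ^ 2 =
        (∑ j ∈ Finset.range n, d j ω) ^ 2 + 2 * ((∑ j ∈ Finset.range n, d j ω) * d n ω) +
          d n ω ^ 2 := fun ω => by
      rw [Finset.sum_range_succ]
      ring
    have hi : Integrable (fun ω => 2 * ((∑ j ∈ Finset.range n, d j ω) * d n ω)) μ :=
      (hS.integrable_mul (hmem n)).const_mul 2
    have hi' : Integrable (fun ω => (∑ j ∈ Finset.range n, d j ω) ^ 2 +
        2 * ((∑ j ∈ Finset.range n, d j ω) * d n ω)) μ := hS.integrable_sq.add hi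
    simp_rw [hexp]
    rw [integral_add hi' (hmem n).integrable_sq, integral_add hS.integrable_sq hi,
      integral_const_mul, hcross]
    push_cast
    linarith

lemma tendsto_average_of_tendsto_squares {d : ℕ → ℝ} {C : ℝ} (hC : ∀ j, |d j| ≤ C)
    (h : Tendsto (fun k : ℕ => (1 / ((k : ℝ) ^ 2)) * ∑ j ∈ Finset.range (k ^ 2), d j)
      atTop (nhds 0)) :
    Tendsto (fun n : ℕ => (1 / (n : ℝ)) * ∑ j ∈ Finset.range n, d j) atTop (nhds 0) := by
  have hsqrt : Tendsto Nat.sqrt atTop atTop :=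
    tendsto_atTop_atTop.2 fun b => ⟨b ^ 2, fun n hn => Nat.le_sqrt'.2 hn⟩
  have hinv : Tendsto (fun k : ℕ => 2 * C / (k : ℝ)) atTop (nhds 0) :=
    tendsto_const_div_atTop_nhds_zero_nat _
  have hbound := (h.abs.add hinv).comp hsqrt
  rw [abs_zero, add_zero] at hbound
  refine squeeze_zero_norm' ?_ hbound
  filter_upwards [eventually_ge_atTop 1] with n hn
  have hk1 : 1 ≤ Nat.sqrt n := Nat.le_sqrt'.2 (by simpa using hn)
  have hkn : Nat.sqrt n ^ 2 ≤ n := Nat.sqrt_le' n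
  have hnk : n ≤ Nat.sqrt n ^ 2 + 2 * Nat.sqrt n := by
    have := Nat.sqrt_le_add n
    nlinarith
  simp only [Function.comp_apply, Real.norm_eq_abs]
  generalize Nat.sqrt n = k at *
  have hk0 : (0 : ℝ) < k := by exact_mod_cast hk1
  have hkn' : (k : ℝ) ^ 2 ≤ n := by exact_mod_cast hkn
  have hC0 : 0 ≤ C := (abs_nonneg _).trans (hC 0)
  have hdiff : |∑ j ∈ Finset.Ico (k ^ 2) n, d j| ≤ 2 * k * C := by
    calc |∑ j ∈ Finset.Ico (k ^ 2) n, d j| ≤ ∑ j ∈ Finset.Ico (k ^ 2) n, |d j| :=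
          Finset.abs_sum_le_sum_abs _ _
      _ ≤ ∑ _j ∈ Finset.Ico (k ^ 2) n, C := Finset.sum_le_sum fun j _ => hC j
      _ = ((n - k ^ 2 : ℕ) : ℝ) * C := by simp
      _ ≤ 2 * k * C := by
          refine mul_le_mul_of_nonneg_right ?_ hC0
          exact_mod_cast (by omega : n - k ^ 2 ≤ 2 * k)
  rw [← Finset.sum_range_add_sum_Ico _ hkn, abs_mul, abs_mul,
    abs_of_nonneg (by positivity : (0 : ℝ) ≤ 1 / n),
    abs_of_nonneg (by positivity : (0 : ℝ) ≤ 1 / (k : ℝ) ^ 2)]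
  calc 1 / (n : ℝ) * |∑ j ∈ Finset.range (k ^ 2), d j + ∑ j ∈ Finset.Ico (k ^ 2) n, d j|
      ≤ 1 / (k : ℝ) ^ 2 * (|∑ j ∈ Finset.range (k ^ 2), d j| + 2 * k * C) := by
        gcongr
        exact (abs_add_le _ _).trans (by gcongr)
    _ = 1 / (k : ℝ) ^ 2 * |∑ j ∈ Finset.range (k ^ 2), d j| + 2 * C / k := by
        field_simp

/-- Strong law of large numbers for bounded orthogonal random variables. -/
lemma ae_tendsto_average_of_orthogonal {d : ℕ → Ω → ℝ} {C : ℝ}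
    (hd : ∀ j, AEStronglyMeasurable (d j) μ) (hC : ∀ j, ∀ᵐ ω ∂μ, |d j ω| ≤ C)
    (horth : ∀ i j, i < j → ∫ ω, d i ω * d j ω ∂μ = 0) :
    ∀ᵐ ω ∂μ, Tendsto (fun n : ℕ => (1 / (n : ℝ)) * ∑ j ∈ Finset.range n, d j ω)
      atTop (nhds 0) := by
  set A : ℕ → Ω → ℝ := fun k ω => (1 / ((k : ℝ) ^ 2)) * ∑ j ∈ Finset.range (k ^ 2), d j ω with hA
  have hmem : ∀ k, MemLp (A k) 2 μ := fun k => by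
    have h : MemLp (fun ω => ∑ j ∈ Finset.range (k ^ 2), d j ω) 2 μ :=
      memLp_finsetSum _ fun j _ => MemLp.of_bound (hd j) C (hC j)
    exact h.const_mul _
  have hint : ∀ k, ∫ ω, A k ω ^ 2 ∂μ ≤ C ^ 2 * (1 / (k : ℝ) ^ 2) := fun k => by
    have h := integral_sq_sum_le_of_orthogonal hd hC horth (k ^ 2)
    simp only [hA, mul_pow, integral_const_mul]
    calc (1 / (k : ℝ) ^ 2) ^ 2 * ∫ ω, (∑ j ∈ Finset.range (k ^ 2), d j ω) ^ 2 ∂μ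
        ≤ (1 / (k : ℝ) ^ 2) ^ 2 * (((k ^ 2 : ℕ) : ℝ) * C ^ 2) := by gcongr
      _ = C ^ 2 * (1 / (k : ℝ) ^ 2) := by
          rcases Nat.eq_zero_or_pos k with rfl | hk
          · simp
          · push_cast
            field_simp
  have hsum : Summable fun k : ℕ => C ^ 2 * (1 / (k : ℝ) ^ 2) :=
    (Real.summable_one_div_nat_pow.2 one_lt_two).mul_left _
  have hfin : ∫⁻ ω, ∑' k, ENNReal.ofReal (A k ω ^ 2) ∂μ ≠ ∞ := by
    rw [lintegral_tsum fun k => ((hmem k).aestronglyMeasurable.aemeasurable.pow_const 2).ennreal_ofReal]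
    refine ne_top_of_le_ne_top hsum.tsum_ofReal_ne_top (ENNReal.tsum_le_tsum fun k => ?_)
    rw [← ofReal_integral_eq_lintegral_ofReal (hmem k).integrable_sq
      (ae_of_all _ fun ω => sq_nonneg _)]
    exact ENNReal.ofReal_le_ofReal (hint k)
  have hae := ae_lt_top' (AEMeasurable.tsum fun k =>
    ((hmem k).aestronglyMeasurable.aemeasurable.pow_const 2).ennreal_ofReal) hfin
  filter_upwards [hae, ae_all_iff.2 hC] with ω h1 h2
  refine tendsto_average_of_tendsto_squares h2 ?_
  have h3 := ENNReal.tendsto_atTop_zero_of_tsum_ne_top h1.ne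
  have h4 : Tendsto (fun k => A k ω ^ 2) atTop (nhds 0) := by
    have := (ENNReal.tendsto_toReal ENNReal.zero_ne_top).comp h3
    simpa [Function.comp_def, ENNReal.toReal_ofReal (sq_nonneg _)] using this
  have h5 := h4.sqrt
  simp only [Real.sqrt_sq_eq_abs, Real.sqrt_zero] at h5
  exact (tendsto_zero_iff_abs_tendsto_zero _).2 h5

end Orthogonal

section Prediction

/-- The prediction error `f(X_{λ_j+1}) - E(f(X_{λ_j+1}) | X_{-∞}^{λ_j})`. -/
def predictionError (μ : Measure (Path 𝒳)) (β γ : ℝ) (l : ℕ → ℕ) (f : 𝒳 → ℝ) (j : ℕ)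
    (ω : Path 𝒳) : ℝ :=
  f (ω (lambda β γ l ω j + 1)) -
    (μ[fun ω' => f (ω' (lambda β γ l ω' j + 1))|fullPastSigma β γ l j]) ω

variable {μ : Measure (Path 𝒳)} {β γ : ℝ} {l : ℕ → ℕ} {f : 𝒳 → ℝ} {M : ℝ}

lemma ae_abs_predictionError_le (hf : ∀ x, |f x| ≤ M) (j : ℕ) :
    ∀ᵐ ω ∂μ, |predictionError μ β γ l f j ω| ≤ 2 * |M| := by
  have h := ae_bdd_abs_condExp_of_ae_bdd_abs (μ := μ) (m := fullPastSigma β γ l j) (R := |M|)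
    (f := fun ω' : Path 𝒳 => f (ω' (lambda β γ l ω' j + 1)))
    (ae_of_all _ fun _ => (hf _).trans (le_abs_self M))
  filter_upwards [h] with ω hω
  calc _ ≤ _ := abs_sub _ _
    _ ≤ |M| + |M| := add_le_add ((hf _).trans (le_abs_self M)) hω
    _ = 2 * |M| := by ring

variable [Countable 𝒳] [MeasurableSingletonClass 𝒳]

lemma measurable_next (β γ : ℝ) (l : ℕ → ℕ) (f : 𝒳 → ℝ) (j : ℕ) :
    Measurable fun ω : Path 𝒳 => f (ω (lambda β γ l ω j + 1)) :=
  (measurable_of_countable f).comp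
    (measurable_eval measurable_id ((measurable_lambda β γ l j).add_const 1))

lemma aestronglyMeasurable_predictionError (hrec : ∀ᵐ ω ∂μ, Recurs l ω) (hlmono : Monotone l)
    (hlle : ∀ k, 1 ≤ k → l k ≤ k) (hltop : Tendsto l atTop atTop) {i j : ℕ} (hij : i < j) :
    AEStronglyMeasurable[fullPastSigma β γ l j] (predictionError μ β γ l f i) μ := by
  obtain ⟨h, hh, heq⟩ := Measurable.exists_eq_measurable_comp (f := fullPastObs β γ l i)
    (stronglyMeasurable_condExp (μ := μ) (m := fullPastSigma β γ l i)
      (f := fun ω' : Path 𝒳 => f (ω' (lambda β γ l ω' i + 1)))).measurable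
  have hH : Measurable fun q : 𝒳 × ℤ × (ℕ → 𝒳) => f q.1 - h q.2 :=
    ((measurable_of_countable f).comp measurable_fst).sub (hh.comp measurable_snd)
  refine ⟨fun ω => (fun q : 𝒳 × ℤ × (ℕ → 𝒳) => f q.1 - h q.2)
    (prefixObs β γ l i (fullPastObs β γ l j ω)), ?_, ?_⟩
  · exact ((hH.comp (measurable_prefixObs β γ l i)).comp
      (comap_measurable (fullPastObs β γ l j))).stronglyMeasurable
  · filter_upwards [hrec] with ω hω
    rw [prefixObs_fullPastObs hlmono hlle hltop hω hij]
    simp only [predictionError, heq, Function.comp_apply]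

variable [IsProbabilityMeasure μ]

lemma integrable_next (hf : ∀ x, |f x| ≤ M) (j : ℕ) :
    Integrable (fun ω : Path 𝒳 => f (ω (lambda β γ l ω j + 1))) μ :=
  Integrable.of_bound (measurable_next β γ l f j).aestronglyMeasurable M (ae_of_all _ fun _ => hf _)

lemma integrable_predictionError (hf : ∀ x, |f x| ≤ M) (j : ℕ) :
    Integrable (predictionError μ β γ l f j) μ :=
  (integrable_next hf j).sub integrable_condExp

lemma condExp_predictionError (hf : ∀ x, |f x| ≤ M) (j : ℕ) :
    μ[predictionError μ β γ l f j|fullPastSigma β γ l j] =ᵐ[μ] 0 := by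
  have hm := fullPastSigma_le (𝒳 := 𝒳) β γ l j
  have h := condExp_sub (integrable_next (μ := μ) (β := β) (γ := γ) (l := l) hf j)
    (integrable_condExp (μ := μ) (m := fullPastSigma β γ l j)
      (f := fun ω' : Path 𝒳 => f (ω' (lambda β γ l ω' j + 1)))) (fullPastSigma β γ l j)
  rw [condExp_of_stronglyMeasurable hm stronglyMeasurable_condExp integrable_condExp, sub_self] at h
  exact h

lemma integral_predictionError_mul (hf : ∀ x, |f x| ≤ M) (hrec : ∀ᵐ ω ∂μ, Recurs l ω)
    (hlmono : Monotone l) (hlle : ∀ k, 1 ≤ k → l k ≤ k) (hltop : Tendsto l atTop atTop)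
    {i j : ℕ} (hij : i < j) :
    ∫ ω, predictionError μ β γ l f i ω * predictionError μ β γ l f j ω ∂μ = 0 := by
  have hi := integrable_predictionError (μ := μ) (β := β) (γ := γ) (l := l) hf i
  have hj := integrable_predictionError (μ := μ) (β := β) (γ := γ) (l := l) hf j
  have hij' : Integrable (predictionError μ β γ l f i * predictionError μ β γ l f j) μ :=
    hj.bdd_mul hi.aestronglyMeasurable (ae_abs_predictionError_le hf i)
  have hpull := condExp_mul_of_aestronglyMeasurable_left
    (aestronglyMeasurable_predictionError hrec hlmono hlle hltop hij) hij' hj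
  rw [← integral_condExp (fullPastSigma_le β γ l j)]
  refine integral_eq_zero_of_ae ?_
  filter_upwards [hpull, condExp_predictionError (β := β) (γ := γ) (l := l) hf j] with ω h1 h2
  refine h1.trans ?_
  simp [h2]

end Prediction

/-- Step 3, first term of (8). The averages of the
martingale differences `f(X_{λ_j+1}) - E(f(X_{λ_j+1}) | X_{-∞}^{λ_j})` tend to
zero almost surely. -/
theorem statement14
    {𝒳 : Type*} [Countable 𝒳] [MeasurableSpace 𝒳] [MeasurableSingletonClass 𝒳]
    (μ : Measure (Path 𝒳)) [IsProbabilityMeasure μ]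
    (hErg : Ergodic (shift : Path 𝒳 → Path 𝒳) μ)
    (l : ℕ → ℕ) (hl1 : l 1 = 1) (hlmono : Monotone l)
    (hlle : ∀ k, 1 ≤ k → l k ≤ k) (hltop : Tendsto l atTop atTop)
    (β γ : ℝ) (hγ0 : 0 < γ) (hγ1 : γ < 1) (hβ0 : 0 < β) (hβγ : 2 * β + γ < 1)
    (f : 𝒳 → ℝ) (hf : ∃ M, ∀ x, |f x| ≤ M) :
    ∀ᵐ ω ∂μ,
      Tendsto (fun n : ℕ => (1 / (n : ℝ)) *
          ∑ j ∈ Finset.range n,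
            (f (ω (lambda β γ l ω j + 1)) -
              (μ[fun ω' => f (ω' (lambda β γ l ω' j + 1))|fullPastSigma β γ l j]) ω))
        atTop (nhds 0) := by
  obtain ⟨M, hM⟩ := hf
  have hrec := ae_recurs hErg.toMeasurePreserving l
  exact ae_tendsto_average_of_orthogonal (d := predictionError μ β γ l f)
    (fun j => (integrable_predictionError hM j).aestronglyMeasurable)
    (ae_abs_predictionError_le hM)
    (fun _ _ hij => integral_predictionError_mul hM hrec hlmono hlle hltop hij)

end MWPrediction
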